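/- arXiv:2002.09433 — 2 statements merged into one kernel-verified Lean document; each statement's English description precedes it below -/
import Mathlib

section
/- Let T_ℚ = ⟨x, y | (y^s)^{c_s} y^{−c_{s−1}}, s = 2, 3, …⟩ be the quotient of the free group F₂ on x and y by the normal closure of the set of words w_s = c_s⁻¹ y^s c_s · c_{s−1}⁻¹ y⁻¹ c_{s−1}, s ≥ 2, where c_i = (x y^i)² x⁻¹. Then there is an injective homomorphism from the additive group ℚ of rational numbers into the 2-generator group T_ℚ which, for every integer i ≥ 1, sends the rational number 1/i! to the image in T_ℚ of the word ā_i(x,y) = c_i⁻¹ y c_i. -/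
/-- The free group of rank 2 on the generators `x` (index 0) and `y` (index 1). -/
abbrev F2 : Type := FreeGroup (Fin 2)

/-- The generator `x` of `F₂`. -/
def xx : F2 := FreeGroup.of 0

/-- The generator `y` of `F₂`. -/
def yy : F2 := FreeGroup.of 1

/-- `c_i = (x y^i)² x⁻¹`. -/
def cc (i : ℕ) : F2 := (xx * yy ^ i) ^ 2 * xx⁻¹

/-- The shorter universal word `ā_i(x,y) = y^{c_i} = c_i⁻¹ y c_i`. -/
def aabar (i : ℕ) : F2 := (cc i)⁻¹ * yy * cc i

/-- The relators `w_s = (y^s)^{c_s} · y^{−c_{s−1}} = c_s⁻¹ y^s c_s · c_{s−1}⁻¹ y⁻¹ c_{s−1}`,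
`s = 2, 3, …`, of the group `T_ℚ`. -/
def TQrels : Set F2 :=
  {w | ∃ s : ℕ, 2 ≤ s ∧
    w = (cc s)⁻¹ * yy ^ s * cc s * ((cc (s - 1))⁻¹ * yy⁻¹ * cc (s - 1))}

section Twist

open Monoid

variable {ι Q : Type*} [Group Q]

/-- The automorphism of a free product of copies of `Q` that permutes the copies by `e` and
acts on the `i`-th copy by `c i`. -/
def copiesAut (e : Equiv.Perm ι) (c : ι → MulAut Q) :
    MulAut (CoprodI fun _ : ι => Q) :=
  MonoidHom.toMulEquiv
    (CoprodI.lift fun i =>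
      (CoprodI.of (M := fun _ : ι => Q) (i := e i)).comp (c i).toMonoidHom)
    (CoprodI.lift fun i =>
      (CoprodI.of (M := fun _ : ι => Q) (i := e.symm i)).comp (c (e.symm i))⁻¹.toMonoidHom)
    (by
      ext i q
      simp)
    (by
      ext i q
      simp)

theorem copiesAut_of (e : Equiv.Perm ι) (c : ι → MulAut Q) (i : ι) (q : Q) :
    copiesAut e c (CoprodI.of (M := fun _ : ι => Q) (i := i) q) =
      CoprodI.of (M := fun _ : ι => Q) (i := e i) (c i q) := by
  simp [copiesAut]

theorem exists_word_prod_eq_copiesAut (e : Equiv.Perm ι) (c : ι → MulAut Q)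
    (v : CoprodI.Word fun _ : ι => Q) :
    ∃ v' : CoprodI.Word fun _ : ι => Q,
      v'.prod = copiesAut e c v.prod ∧ v'.fstIdx = v.fstIdx.map e := by
  induction v using CoprodI.Word.consRecOn with
  | empty => exact ⟨CoprodI.Word.empty, by simp, rfl⟩
  | cons i m v h1 h2 ih =>
    obtain ⟨v', hv', hf⟩ := ih
    refine ⟨CoprodI.Word.cons (M := fun _ : ι => Q) (i := e i) (c i m) v' ?_ ?_, ?_, ?_⟩
    · rw [hf]
      intro h
      obtain ⟨j, hj, hji⟩ := Option.map_eq_some_iff.1 h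
      exact h1 (by rw [hj, e.injective hji])
    · simpa using h2
    · simp [hv', copiesAut_of]
    · simp

variable (Q) in
/-- The action of `ℤ` by translation of indices on a free product of copies of `Q` indexed
by `ℤ`. -/
def shiftHom : Multiplicative ℤ →* MulAut (CoprodI fun _ : ℤ => Q) where
  toFun n := copiesAut (Equiv.addRight n.toAdd) 1
  map_one' := by
    apply MulEquiv.toMonoidHom_injective
    ext i q
    simp [copiesAut_of]
  map_mul' m n := by
    apply MulEquiv.toMonoidHom_injective
    ext i q
    simp [copiesAut_of, add_assoc, add_comm m.toAdd]

theorem shiftHom_of (n i : ℤ) (q : Q) :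
    shiftHom Q (Multiplicative.ofAdd n) (CoprodI.of (M := fun _ : ℤ => Q) (i := i) q) =
      CoprodI.of (M := fun _ : ℤ => Q) (i := i + n) q := by
  simp [shiftHom, copiesAut_of]

end Twist

theorem FreeGroup.exists_eq_of_zpow_of_unique {α : Type*} [Unique α] (h : FreeGroup α) :
    ∃ n : ℤ, h = FreeGroup.of default ^ n := by
  induction h using FreeGroup.induction_on with
  | C1 => exact ⟨0, by simp⟩
  | of a => exact ⟨1, by simp [Unique.eq_default a]⟩
  | inv_of a ih => exact ⟨-1, by simp [Unique.eq_default a]⟩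
  | mul a b iha ihb =>
    obtain ⟨m, rfl⟩ := iha
    obtain ⟨n, rfl⟩ := ihb
    exact ⟨m + n, (zpow_add _ _ _).symm⟩

section PingPong

open Monoid Cardinal Pointwise Function

/-- A form of the ping-pong lemma for free groups in which nonzero powers of the generators
are played on single sets. -/
theorem FreeGroup.injective_lift_of_zpow_ping_pong {ι G α : Type} [Nontrivial ι] [Group G]
    [MulAction G α] (a : ι → G) (X : ι → Set α) (hX : ∀ i, (X i).Nonempty)
    (hd : Pairwise (Disjoint on X))
    (hpp : ∀ i j, i ≠ j → ∀ n : ℤ, n ≠ 0 → ∀ p ∈ X j, a i ^ n • p ∈ X i) :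
    Function.Injective (FreeGroup.lift a) := by
  have : FreeGroup.lift a =
      (CoprodI.lift fun i => FreeGroup.lift fun _ => a i).comp
        (@freeGroupEquivCoprodI ι).toMonoidHom := by
    ext i
    simp
  rw [this, MonoidHom.coe_comp]
  refine Function.Injective.comp ?_ (MulEquiv.injective freeGroupEquivCoprodI)
  refine CoprodI.lift_injective_of_ping_pong (fun i => FreeGroup.lift fun _ : Unit => a i)
    ?_ X hX hd ?_
  · inhabit ι
    refine Or.inr ⟨default, ?_⟩
    simp only [FreeGroup.freeGroupUnitEquivInt.cardinal_eq, Cardinal.mk_denumerable]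
    exact (Cardinal.natCast_lt_aleph0 (n := 3)).le
  · rintro i j hij h hh _ ⟨p, hp, rfl⟩
    obtain ⟨n, rfl⟩ := FreeGroup.exists_eq_of_zpow_of_unique h
    have hn : n ≠ 0 := by
      rintro rfl
      simp at hh
    simpa using hpp i j hij n hn p hp

end PingPong

section Shift

open Monoid

variable {Q : Type} [Group Q]

/-- Left translation by an element `q` of the `0`-th copy and an index shift generate a free group
when `q` has infinite order. -/
theorem injective_lift_shift_translation (q : Q) (hq : ∀ n : ℤ, n ≠ 0 → q ^ n ≠ 1) :
    Function.Injective (FreeGroup.lift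
      ![MulAut.toPerm _ (shiftHom Q (Multiplicative.ofAdd (-1))),
        MulAction.toPermHom (CoprodI fun _ : ℤ => Q) (CoprodI fun _ : ℤ => Q)
          (CoprodI.of (M := fun _ : ℤ => Q) (i := 0) q)]) := by
  have hq1 : q ≠ 1 := by simpa using hq 1 one_ne_zero
  let X : Fin 2 → Set (CoprodI fun _ : ℤ => Q) := fun i =>
    {g | ∃ (v : CoprodI.Word fun _ : ℤ => Q) (j : ℤ),
      v.prod = g ∧ v.fstIdx = some j ∧ (j = 0 ↔ i = 1)}
  refine FreeGroup.injective_lift_of_zpow_ping_pong _ X ?_ ?_ ?_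
  · intro i
    by_cases hi : i = 1
    · exact ⟨_, CoprodI.Word.cons (M := fun _ : ℤ => Q) (i := 0) q CoprodI.Word.empty
        nofun hq1, 0, rfl, by simp, by simp [hi]⟩
    · exact ⟨_, CoprodI.Word.cons (M := fun _ : ℤ => Q) (i := 1) q CoprodI.Word.empty
        nofun hq1, 1, rfl, by simp, by simp [hi]⟩
  · intro i i' hii'
    refine Set.disjoint_left.2 ?_
    rintro _ ⟨v, j, rfl, hj, hji⟩ ⟨v', j', hv', hj', hji'⟩
    classical
    obtain rfl : v' = v := CoprodI.Word.equiv.symm.injective hv'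
    obtain rfl : j' = j := Option.some_injective _ (hj'.symm.trans hj)
    omega
  · rintro i i' hii' n hn _ ⟨v, j, rfl, hj, hji⟩
    obtain ⟨rfl, rfl⟩ | ⟨rfl, rfl⟩ : (i = 0 ∧ i' = 1) ∨ (i = 1 ∧ i' = 0) := by
      clear hji
      decide +revert
    · obtain rfl : j = 0 := by simpa using hji
      obtain ⟨v', hv', hf⟩ :=
        exists_word_prod_eq_copiesAut (Equiv.addRight (-n)) (1 : ℤ → MulAut Q) v
      refine ⟨v', -n, ?_, by simp [hf, hj], by simpa using hn⟩
      rw [hv', Matrix.cons_val_zero, ← map_zpow, ← map_zpow, ← ofAdd_zsmul]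
      simp only [shiftHom, smul_eq_mul, mul_neg, mul_one]
      rfl
    · have hj0 : j ≠ 0 := by simpa using hji
      refine ⟨CoprodI.Word.cons (M := fun _ : ℤ => Q) (i := 0) (q ^ n) v (by simp [hj, hj0])
        (hq n hn), 0, ?_, by simp, by simp⟩
      rw [CoprodI.Word.prod_cons, Matrix.cons_val_one, Matrix.cons_val_fin_one, ← map_zpow,
        ← map_zpow]
      simp

end Shift

/-- If two pairs `(y, z)` and `(w, y)` freely generate subgroups of `G`, then `G` embeds in a group
with an element conjugating `z` to `y` and `y` to `w`. -/
theorem exists_conj_of_free {G : Type} [Group G] (y z w : G)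
    (hyz : Function.Injective (FreeGroup.lift ![y, z]))
    (hwy : Function.Injective (FreeGroup.lift ![w, y])) :
    ∃ (E : Type) (_ : Group E) (f : G →* E) (t : E), Function.Injective f ∧
      t * f z * t⁻¹ = f y ∧ t * f y * t⁻¹ = f w := by
  let eA := MonoidHom.ofInjective hyz
  let eB := MonoidHom.ofInjective hwy
  let e := eA.symm.trans eB
  have he : ∀ i : Fin 2, HNNExtension.of (φ := e) (![w, y] i) =
      HNNExtension.t * HNNExtension.of (![y, z] i) * HNNExtension.t⁻¹ := by
    intro i
    have h := HNNExtension.equiv_eq_conj (φ := e) (eA (FreeGroup.of i))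
    simpa [e, eA, eB, MonoidHom.ofInjective_apply] using h
  exact ⟨HNNExtension G _ _ e, inferInstance, HNNExtension.of, HNNExtension.t,
    HNNExtension.of_injective e, (he 1).symm, (he 0).symm⟩

/-- A group whose elements satisfy `u z_k u⁻¹ = z_k ^ (k + 1)` for `z_k = y⁻ᵏ z yᵏ`, in which
`(y, z)` and `(y⁻¹ u, y)` are free pairs. -/
theorem exists_free_pairs_conj_pow :
    ∃ (G : Type) (_ : Group G) (y z u : G),
      Function.Injective (FreeGroup.lift ![y, z]) ∧
      Function.Injective (FreeGroup.lift ![y⁻¹ * u, y]) ∧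
      ∀ k : ℕ, u * ((y ^ k)⁻¹ * z * y ^ k) * u⁻¹ = ((y ^ k)⁻¹ * z * y ^ k) ^ (k + 1) := by
  let N := Monoid.CoprodI fun _ : ℤ => Multiplicative ℚ
  let z₀ : ℤ → N := fun i => Monoid.CoprodI.of (M := fun _ : ℤ => Multiplicative ℚ) (i := i)
    (Multiplicative.ofAdd 1)
  let L : N →* Equiv.Perm N := MulAction.toPermHom N N
  let S : MulAut N →* Equiv.Perm N := MulAut.toPerm N
  have hSL : ∀ (σ : MulAut N) (g : N), S σ * L g * (S σ)⁻¹ = L (σ g) := by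
    intro σ g
    ext h
    have : σ ((S σ)⁻¹ h) = h := (S σ).apply_symm_apply h
    exact (map_mul σ g _).trans (congrArg (σ g * ·) this)
  let σ : MulAut N := copiesAut 1 fun k => AddEquiv.toMultiplicative
    (DistribMulAction.toAddEquiv₀ ℚ ((k.natAbs : ℚ) + 1) (by positivity))
  let τ : MulAut N := shiftHom (Multiplicative ℚ) (Multiplicative.ofAdd (-1))
  have hτ : ∀ k : ℕ, (τ ^ k)⁻¹ (z₀ 0) = z₀ k := by
    intro k
    simp only [τ, z₀]
    rw [← map_pow, ← map_inv, ← ofAdd_nsmul, ← ofAdd_neg, shiftHom_of]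
    simp
  have hσ : ∀ k : ℕ, σ (z₀ k) = z₀ k ^ (k + 1) := by
    intro k
    simp only [σ, z₀]
    rw [copiesAut_of, ← map_pow, ← ofAdd_nsmul]
    congr 1
    apply Multiplicative.toAdd.injective
    simp [DistribMulAction.toAddEquiv₀]
  let y : Equiv.Perm N × F2 := (S τ, xx)
  let z : Equiv.Perm N × F2 := (L (z₀ 0), 1)
  let u : Equiv.Perm N × F2 := (S σ, yy)
  refine ⟨_, inferInstance, y, z, u, ?_, ?_, ?_⟩
  · have h : (MonoidHom.fst (Equiv.Perm N) F2).comp (FreeGroup.lift ![y, z]) =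
        FreeGroup.lift ![S τ, L (z₀ 0)] := by
      ext i : 1
      fin_cases i <;> simp [y, z]
    refine Function.Injective.of_comp (f := MonoidHom.fst (Equiv.Perm N) F2) ?_
    rw [← MonoidHom.coe_comp, h]
    refine injective_lift_shift_translation _ fun n hn => ?_
    rw [← ofAdd_zsmul]
    simpa using hn
  · have h : ((FreeGroup.lift ![yy, yy * xx]).comp (MonoidHom.snd (Equiv.Perm N) F2)).comp
        (FreeGroup.lift ![y⁻¹ * u, y]) = MonoidHom.id F2 := by
      ext i
      fin_cases i <;> simp [y, u, xx, yy]
    refine Function.Injective.of_comp (f := (FreeGroup.lift ![yy, yy * xx]).comp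
      (MonoidHom.snd (Equiv.Perm N) F2)) ?_
    rw [← MonoidHom.coe_comp, h]
    exact Function.injective_id
  · intro k
    have hz : (y ^ k)⁻¹ * z * y ^ k = (L (z₀ k), 1) := by
      have := hSL (τ ^ k)⁻¹ (z₀ 0)
      rw [hτ] at this
      ext1
      · simpa [y, z] using this
      · simp [y, z]
    rw [hz]
    ext1
    · simp [u, hSL, hσ]
    · simp [u]

theorem relator_eq_one_of_conj_pow {E : Type*} [Group E] (x y z w u : E)
    (hz : x * z * x⁻¹ = y) (hw : x * y * x⁻¹ = w) (hu : y * w = u)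
    (h : ∀ k : ℕ, u * ((y ^ k)⁻¹ * z * y ^ k) * u⁻¹ = ((y ^ k)⁻¹ * z * y ^ k) ^ (k + 1))
    (k : ℕ) :
    ((x * y ^ (k + 1)) ^ 2 * x⁻¹)⁻¹ * y ^ (k + 1) * ((x * y ^ (k + 1)) ^ 2 * x⁻¹) *
      (((x * y ^ k) ^ 2 * x⁻¹)⁻¹ * y⁻¹ * ((x * y ^ k) ^ 2 * x⁻¹)) = 1 := by
  have key : ∀ i m : ℕ, ((x * y ^ i) ^ 2 * x⁻¹)⁻¹ * y ^ m * ((x * y ^ i) ^ 2 * x⁻¹) =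
      (w ^ i)⁻¹ * ((y ^ i)⁻¹ * z * y ^ i) ^ m * w ^ i := by
    intro i m
    have hzm : y ^ m = x * z ^ m * x⁻¹ := by rw [← hz, conj_pow]
    have hwi : w ^ i = x * y ^ i * x⁻¹ := by rw [← hw, conj_pow]
    have hc : ((y ^ i)⁻¹ * z * y ^ i) ^ m = (y ^ i)⁻¹ * z ^ m * y ^ i := by
      simpa using conj_pow (a := (y ^ i)⁻¹) (b := z) (i := m)
    rw [hc, hwi, hzm, pow_two]
    group
  have hinv : ((x * y ^ k) ^ 2 * x⁻¹)⁻¹ * y⁻¹ * ((x * y ^ k) ^ 2 * x⁻¹) =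
      ((w ^ k)⁻¹ * ((y ^ k)⁻¹ * z * y ^ k) * w ^ k)⁻¹ := by
    have := key k 1
    rw [pow_one, pow_one] at this
    rw [← this]
    group
  have hs : ((y ^ (k + 1))⁻¹ * z * y ^ (k + 1)) ^ (k + 1) =
      w * ((y ^ k)⁻¹ * z * y ^ k) * w⁻¹ := by
    have h1 : (y ^ (k + 1))⁻¹ * z * y ^ (k + 1) = y⁻¹ * ((y ^ k)⁻¹ * z * y ^ k) * y⁻¹⁻¹ := by
      rw [pow_succ]
      group
    rw [h1, conj_pow, ← h k, ← hu]
    group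
  rw [key, hinv, hs, pow_succ]
  group

/-- The element `y` has infinite order in `T_ℚ`. -/
theorem mk_yy_zpow_ne_one (n : ℤ) (hn : n ≠ 0) :
    (QuotientGroup.mk yy : F2 ⧸ Subgroup.normalClosure TQrels) ^ n ≠ 1 := by
  obtain ⟨G, _, y, z, u, hyz, hwy, hu⟩ := exists_free_pairs_conj_pow
  obtain ⟨E, _, f, t, hf, hz, hw⟩ := exists_conj_of_free y z (y⁻¹ * u) hyz hwy
  let ψ : F2 →* E := FreeGroup.lift ![t, f y]
  have hx : ψ xx = t := by simp [ψ, xx]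
  have hy : ψ yy = f y := by simp [ψ, yy]
  have hle : Subgroup.normalClosure TQrels ≤ ψ.ker := by
    refine Subgroup.normalClosure_le_normal ?_
    rintro _ ⟨s, hs, rfl⟩
    obtain ⟨k, rfl⟩ : ∃ k, s = k + 1 := ⟨s - 1, by omega⟩
    have := relator_eq_one_of_conj_pow t (f y) (f z) (f (y⁻¹ * u)) (f u) hz hw (by simp)
      (fun k => by simpa using congrArg f (hu k)) k
    simpa [MonoidHom.mem_ker, cc, hx, hy] using this
  intro h
  rw [← QuotientGroup.mk_zpow, QuotientGroup.eq_one_iff] at h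
  have h1 : f (y ^ n) = 1 := by simpa [MonoidHom.mem_ker, hy] using hle h
  have h2 : FreeGroup.lift ![y, z] (FreeGroup.of 0 ^ n) = 1 := by
    simpa using hf (h1.trans f.map_one.symm)
  exact FreeGroup.of_ne_one 0
    ((IsMulTorsionFree.zpow_eq_one_iff_left hn).1 (hyz (h2.trans (map_one _).symm)))

section Rationals

open Nat

variable {T : Type*} [Group T] {a : ℕ → T}

theorem eq_pow_of_pow_succ (ha : ∀ s, 1 ≤ s → a (s + 1) ^ (s + 1) = a s) {m n : ℕ} (hm : 1 ≤ m)
    (hmn : m ≤ n) : ∃ k : ℕ, k * m ! = n ! ∧ a m = a n ^ k := by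
  induction n, hmn using Nat.le_induction with
  | base => exact ⟨1, by simp, by simp⟩
  | succ n hmn ih =>
    obtain ⟨k, hk, h⟩ := ih
    refine ⟨(n + 1) * k, by rw [mul_assoc, hk, factorial_succ], ?_⟩
    rw [h, pow_mul, ha n (hm.trans hmn)]

theorem zpow_eq_zpow_of_div_factorial_eq (ha : ∀ s, 1 ≤ s → a (s + 1) ^ (s + 1) = a s)
    {m n : ℕ} (hm : 1 ≤ m) (hn : 1 ≤ n) {p q : ℤ} (h : (p : ℚ) / m ! = q / n !) :
    a m ^ p = a n ^ q := by
  wlog hmn : m ≤ n generalizing m n p q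
  · exact (this hn hm h.symm (by omega)).symm
  obtain ⟨k, hk, hak⟩ := eq_pow_of_pow_succ ha hm hmn
  have hpk : (k : ℤ) * p = q := by
    have hm0 : (m ! : ℚ) ≠ 0 := by positivity
    have hn0 : (n ! : ℚ) ≠ 0 := by positivity
    rw [div_eq_div_iff hm0 hn0, ← hk] at h
    push_cast at h
    have : ((k : ℚ) * p) = q := mul_right_cancel₀ hm0 (by linarith)
    exact_mod_cast this
  rw [hak, ← hpk, zpow_mul, zpow_natCast]

theorem exists_eq_div_factorial (q : ℚ) {n : ℕ} (hn : q.den ≤ n) :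
    ∃ p : ℤ, q = (p : ℚ) / n ! := by
  obtain ⟨k, hk⟩ := Nat.dvd_factorial q.pos hn
  refine ⟨q.num * k, ?_⟩
  have hk0 : (k : ℚ) ≠ 0 := by
    rintro h
    obtain rfl : k = 0 := by exact_mod_cast h
    exact factorial_ne_zero n (by simpa using hk)
  rw [hk]
  push_cast
  rw [mul_div_mul_right _ _ hk0, Rat.num_div_den]

/-- A root tower `a (s + 1) ^ (s + 1) = a s` defines a homomorphism from `ℚ`. -/
theorem exists_hom_rat_of_pow_succ (ha : ∀ s, 1 ≤ s → a (s + 1) ^ (s + 1) = a s) :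
    ∃ f : Multiplicative ℚ →* T, ∀ (n : ℕ) (p : ℤ), 1 ≤ n →
      f (Multiplicative.ofAdd ((p : ℚ) / n !)) = a n ^ p := by
  choose p hp using fun q : ℚ => exists_eq_div_factorial q le_rfl
  have key : ∀ (q : ℚ) (n : ℕ) (r : ℤ), 1 ≤ n → q = (r : ℚ) / n ! → a q.den ^ p q = a n ^ r :=
    fun q n r hn h => zpow_eq_zpow_of_div_factorial_eq ha q.pos hn ((hp q).symm.trans h)
  refine ⟨MonoidHom.mk' (fun q => a q.toAdd.den ^ p q.toAdd) fun q r => ?_,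
    fun n r hn => key _ n r hn rfl⟩
  obtain ⟨i, hi⟩ := exists_eq_div_factorial q.toAdd (le_max_left _ r.toAdd.den)
  obtain ⟨j, hj⟩ := exists_eq_div_factorial r.toAdd (le_max_right q.toAdd.den _)
  have hn : 1 ≤ max q.toAdd.den r.toAdd.den := le_max_of_le_left q.toAdd.pos
  rw [key _ _ i hn hi, key _ _ j hn hj, ← zpow_add]
  refine key _ _ _ hn ?_
  rw [toAdd_mul, Int.cast_add, add_div, ← hi, ← hj]

end Rationals

/-- **Example (embedding of ℚ).**  There is an injective homomorphism of the additive group `ℚ`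
of rational numbers into the 2-generator group
`T_ℚ = ⟨x, y | (y^s)^{c_s} y^{−c_{s−1}}, s = 2, 3, …⟩` which, for every `i ≥ 1`, sends the
rational number `1/i!` to the image in `T_ℚ` of the word `ā_i(x,y) = c_i⁻¹ y c_i`. -/
theorem rationals_embed :
    ∃ φ : Multiplicative ℚ →* F2 ⧸ Subgroup.normalClosure TQrels,
      Function.Injective φ ∧
      ∀ i : ℕ, 1 ≤ i →
        φ (Multiplicative.ofAdd ((1 : ℚ) / (i.factorial : ℚ)))
          = QuotientGroup.mk (aabar i) := by
  let π : F2 →* F2 ⧸ Subgroup.normalClosure TQrels := QuotientGroup.mk' _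
  have ha : ∀ s, 1 ≤ s → π (aabar (s + 1)) ^ (s + 1) = π (aabar s) := by
    intro s hs
    have hmem : aabar (s + 1) ^ (s + 1) * (aabar s)⁻¹ ∈ Subgroup.normalClosure TQrels := by
      refine Subgroup.subset_normalClosure ⟨s + 1, by omega, ?_⟩
      have hc : aabar (s + 1) ^ (s + 1) = (cc (s + 1))⁻¹ * yy ^ (s + 1) * cc (s + 1) := by
        simpa [aabar] using conj_pow (a := (cc (s + 1))⁻¹) (b := yy) (i := s + 1)
      rw [hc, Nat.add_sub_cancel, aabar]
      group
    rw [← mul_inv_eq_one, ← map_pow, ← map_inv, ← map_mul]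
    exact (QuotientGroup.eq_one_iff _).2 hmem
  obtain ⟨φ, hφ⟩ := exists_hom_rat_of_pow_succ (a := fun s => π (aabar s)) ha
  refine ⟨φ, (injective_iff_map_eq_one φ).2 fun q hq => ?_, fun i hi => ?_⟩
  · by_contra hq1
    have hnum : q.toAdd.num ≠ 0 := fun h => hq1 (Rat.num_eq_zero.1 h)
    have h1 := hφ 1 q.toAdd.num le_rfl
    have hpow : q ^ q.toAdd.den =
        Multiplicative.ofAdd ((q.toAdd.num : ℚ) / (Nat.factorial 1 : ℚ)) := by
      apply Multiplicative.toAdd.injective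
      simp [toAdd_pow, Rat.den_mul_eq_num]
    rw [← hpow, map_pow, hq, one_pow] at h1
    refine mk_yy_zpow_ne_one _ hnum ?_
    have hc : aabar 1 ^ q.toAdd.num = (cc 1)⁻¹ * yy ^ q.toAdd.num * cc 1 := by
      simpa [aabar] using conj_zpow (a := (cc 1)⁻¹) (b := yy) (i := q.toAdd.num)
    rw [← map_zpow, hc, map_mul, map_mul, map_inv, eq_comm, mul_eq_one_iff_eq_inv,
      mul_eq_left] at h1
    rw [← QuotientGroup.mk_zpow]
    exact h1
  · have h := hφ i 1 hi
    rwa [Int.cast_one, zpow_one] at h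
end

section
/- Let p be a prime, and let P = ⟨a_1, a_2, … | a_1^p, a_{s+1}^p a_s⁻¹, s = 1, 2, …⟩ be the quotient of the free group on a countable alphabet {a_1, a_2, …} by the normal closure of the relators a_1^p and a_{s+1}^p a_s⁻¹ (s ≥ 1), so that P is the quasicyclic Prüfer p-group C_{p^∞}. Let T = ⟨x, y | a_1(x,y)^p, a_{s+1}(x,y)^p a_s(x,y)⁻¹, s = 1, 2, …⟩ be the quotient of the free group F₂ on x and y by the normal closure of the corresponding words in the universal words a_i(x,y). Then the map a_i ↦ a_i(x,y) induces a well-defined injective homomorphism from P into the 2-generator group T sending the coset of a_i to the coset of a_i(x,y) for every i ≥ 1. -/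
/-- The universal word `a_i(x,y) = y^{c_i} · y^{-x} = c_i⁻¹ y c_i · x⁻¹ y⁻¹ x`. -/
def aa (i : ℕ) : F2 := (cc i)⁻¹ * yy * cc i * (xx⁻¹ * yy⁻¹ * xx)

/-- The relators `a_1^p` and `a_{s+1}^p a_s⁻¹`, `s = 1, 2, …`, of the Prüfer `p`-group
`C_{p^∞} = ⟨a_1, a_2, … | a_1^p, a_{s+1}^p = a_s⟩`; the alphabet is indexed by `ℕ`, index `i`
corresponding to the generator `a_{i+1}`. -/
def pruferRels (p : ℕ) : Set (FreeGroup ℕ) :=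
  {FreeGroup.of 0 ^ p} ∪
    {w | ∃ s : ℕ, w = FreeGroup.of (s + 1) ^ p * (FreeGroup.of s)⁻¹}

/-- The corresponding relators `a_1(x,y)^p` and `a_{s+1}(x,y)^p a_s(x,y)⁻¹`, `s = 1, 2, …`, of
the 2-generator group `T`. -/
def pruferTargetRels (p : ℕ) : Set F2 :=
  {aa 1 ^ p} ∪ {w | ∃ s : ℕ, 1 ≤ s ∧ w = aa (s + 1) ^ p * (aa s)⁻¹}

universe u

namespace Equiv.Perm

/-- The shift of the first coordinate of `ℤ × P × P`. -/
def shift (P : Type*) : Equiv.Perm (ℤ × P × P) :=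
  (Equiv.addRight (1 : ℤ)).prodCongr (Equiv.refl _)

/-- Left multiplication of the second coordinate by a function of the first one. -/
def twist {P : Type*} [Group P] (A : ℤ → P) : Equiv.Perm (ℤ × P × P) where
  toFun z := (z.1, A z.1 * z.2.1, z.2.2)
  invFun z := (z.1, (A z.1)⁻¹ * z.2.1, z.2.2)
  left_inv z := by simp
  right_inv z := by simp

/-- Left multiplication of the third coordinate by the second one over `0`. -/
def mulAtZero (P : Type*) [Group P] : Equiv.Perm (ℤ × P × P) where
  toFun z := (z.1, z.2.1, if z.1 = 0 then z.2.1 * z.2.2 else z.2.2)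
  invFun z := (z.1, z.2.1, if z.1 = 0 then z.2.1⁻¹ * z.2.2 else z.2.2)
  left_inv z := by ext <;> simp; split_ifs <;> simp
  right_inv z := by ext <;> simp; split_ifs <;> simp

/-- Left translation of the third coordinate over `0`. -/
def translateAtZero (P : Type*) [Group P] : P →* Equiv.Perm (ℤ × P × P) where
  toFun c :=
    { toFun z := (z.1, z.2.1, if z.1 = 0 then c * z.2.2 else z.2.2)
      invFun z := (z.1, z.2.1, if z.1 = 0 then c⁻¹ * z.2.2 else z.2.2)
      left_inv z := by ext <;> simp; split_ifs <;> simp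
      right_inv z := by ext <;> simp; split_ifs <;> simp }
  map_one' := by ext z <;> simp
  map_mul' c d := by ext z <;> simp; split_ifs <;> simp [mul_assoc]

theorem translateAtZero_injective {P : Type*} [Group P] :
    Function.Injective (translateAtZero P) := by
  intro c d h
  simpa [translateAtZero] using congrArg (fun σ : Equiv.Perm (ℤ × P × P) => σ (0, 1, 1)) h

theorem shift_pow_apply {P : Type*} (i : ℕ) (z : ℤ × P × P) :
    (shift P ^ i) z = (z.1 + i, z.2) := by
  induction i with
  | zero => simp
  | succ i ih => rw [pow_succ', Equiv.Perm.mul_apply, ih]; simp [shift, add_assoc]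

theorem shift_pow_inv_apply {P : Type*} (i : ℕ) (z : ℤ × P × P) :
    (shift P ^ i)⁻¹ z = (z.1 - i, z.2) := by
  rw [Equiv.Perm.inv_eq_iff_eq, shift_pow_apply]; simp

theorem twist_inv_apply {P : Type*} [Group P] (A : ℤ → P) (z : ℤ × P × P) :
    (twist A)⁻¹ z = (z.1, (A z.1)⁻¹ * z.2.1, z.2.2) := rfl

/-- The commutator of `shift ^ i` with `twist A` multiplies the second coordinate over `0` by
`A (-i)`, hence conjugates `mulAtZero` to its product with a translation by `A (-i)`. -/
theorem mulAtZero_mul_commutator {P : Type*} [Group P] (A : ℤ → P) (hA : A 0 = 1) (i : ℕ) :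
    mulAtZero P * (shift P ^ i * (twist A * (shift P)⁻¹ * (twist A)⁻¹) ^ i) =
      shift P ^ i * (twist A * (shift P)⁻¹ * (twist A)⁻¹) ^ i *
        (translateAtZero P (A (-i)) * mulAtZero P) := by
  rw [conj_pow, inv_pow]
  ext1 z
  obtain ⟨n, a, b⟩ := z
  simp only [Equiv.Perm.mul_apply, shift_pow_apply, shift_pow_inv_apply, twist_inv_apply]
  by_cases hn : n = 0
  · subst hn
    simp [twist, mulAtZero, translateAtZero, hA, mul_assoc]
  · simp [twist, mulAtZero, translateAtZero, hn]

end Equiv.Perm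

theorem FreeGroup.lift_injective_of_comp {α M N : Type*} [Group M] [Group N] (g : α → M)
    (q : M →* N) (r : N →* FreeGroup α) (h : ∀ k, r (q (g k)) = FreeGroup.of k) :
    Function.Injective (FreeGroup.lift g) := by
  have hc : (r.comp q).comp (FreeGroup.lift g) = MonoidHom.id _ := by
    ext k; simp [h]
  exact Function.LeftInverse.injective (g := r.comp q) fun w => DFunLike.congr_fun hc w

/-- Two injective homomorphisms from the same group become conjugate in a larger group. -/
theorem exists_conj_of_injective {K : Type*} {M : Type u} [Group K] [Group M] (f g : K →* M)
    (hf : Function.Injective f) (hg : Function.Injective g) :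
    ∃ (G : Type u) (_ : Group G) (j : M →* G) (t : G), Function.Injective j ∧
      ∀ k, t * j (f k) * t⁻¹ = j (g k) := by
  let φ : f.range ≃* g.range := (MonoidHom.ofInjective hf).symm.trans (MonoidHom.ofInjective hg)
  refine ⟨HNNExtension M f.range g.range φ, inferInstance, HNNExtension.of, HNNExtension.t,
    HNNExtension.of_injective φ, fun k => ?_⟩
  have h := HNNExtension.t_mul_of (φ := φ) (MonoidHom.ofInjective hf k)
  have hk : φ (MonoidHom.ofInjective hf k) = MonoidHom.ofInjective hg k := by simp [φ]
  rw [hk] at h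
  simpa [MonoidHom.ofInjective_apply] using mul_inv_eq_of_eq_mul h

theorem map_aa {G : Type*} [Group G] (f : F2 →* G) (i : ℕ) :
    f (aa i) =
      (f yy ^ i * (f xx * f yy * (f xx)⁻¹) ^ i)⁻¹ * ((f xx)⁻¹ * f yy * f xx) *
        (f yy ^ i * (f xx * f yy * (f xx)⁻¹) ^ i) * ((f xx)⁻¹ * f yy * f xx)⁻¹ := by
  rw [conj_pow]
  simp only [aa, cc, pow_two, map_mul, map_inv, map_pow]
  group

/-- Every sequence in a group is the image of the universal words `a_1, a_2, …` in some
overgroup. -/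
theorem exists_overgroup_aa {P : Type u} [Group P] (s : ℕ → P) :
    ∃ (G : Type u) (_ : Group G) (j : P →* G) (f : F2 →* G), Function.Injective j ∧
      ∀ i, f (aa (i + 1)) = j (s i) := by
  let A : ℤ → P
    | Int.ofNat _ => 1
    | Int.negSucc i => s i
  let Y := Equiv.Perm.shift P
  let V := Equiv.Perm.twist A * Y⁻¹ * (Equiv.Perm.twist A)⁻¹
  let U := Equiv.Perm.mulAtZero P
  let v : Equiv.Perm (ℤ × P × P) × F2 × F2 := (V, xx, xx⁻¹)
  let y : Equiv.Perm (ℤ × P × P) × F2 × F2 := (Y, yy, xx)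
  let u : Equiv.Perm (ℤ × P × P) × F2 × F2 := (U, 1, yy)
  have hvy : Function.Injective (FreeGroup.lift ![v, y]) :=
    FreeGroup.lift_injective_of_comp _ (MonoidHom.snd _ _) (MonoidHom.fst _ _) fun k => by
      fin_cases k <;> rfl
  have hyu : Function.Injective (FreeGroup.lift ![y, u]) :=
    FreeGroup.lift_injective_of_comp _ (MonoidHom.snd _ _) (MonoidHom.snd _ _) fun k => by
      fin_cases k <;> rfl
  obtain ⟨G, _, j, t, hj, ht⟩ := exists_conj_of_injective _ _ hvy hyu
  have hv : t * j v * t⁻¹ = j y := by simpa using ht (FreeGroup.of 0)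
  have hu : t * j y * t⁻¹ = j u := by simpa using ht (FreeGroup.of 1)
  have hv' : t⁻¹ * j y * t = j v := by rw [← hv]; group
  refine ⟨G, inferInstance, j.comp ((MonoidHom.inl _ _).comp (Equiv.Perm.translateAtZero P)),
    FreeGroup.lift ![t⁻¹, j y], ?_, fun i => ?_⟩
  · exact hj.comp ((Prod.mk_left_injective 1).comp Equiv.Perm.translateAtZero_injective)
  · have hx : FreeGroup.lift ![t⁻¹, j y] xx = t⁻¹ := by simp [xx]
    have hy : FreeGroup.lift ![t⁻¹, j y] yy = j y := by simp [yy]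
    rw [map_aa, hx, hy, inv_inv, hv', hu]
    simp only [← map_pow, ← map_mul, ← map_inv, MonoidHom.comp_apply]
    congr 1
    rw [mul_inv_eq_iff_eq_mul, mul_assoc, inv_mul_eq_iff_eq_mul]
    refine Prod.ext ?_ (Prod.ext ?_ ?_)
    · exact Equiv.Perm.mulAtZero_mul_commutator A rfl (i + 1)
    · simp [u]
    · simp [u, v, y]

/-- **Example (embedding of the Prüfer group).**  Let `p` be a prime and let
`P = ⟨a_1, a_2, … | a_1^p, a_{s+1}^p a_s⁻¹, s = 1, 2, …⟩` be the quasicyclic Prüfer `p`-group,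
presented as a quotient of the free group on a countable alphabet.  Then the map
`a_i ↦ a_i(x,y)` induces a well-defined injective homomorphism of `P` into the 2-generator group
`T = ⟨x, y | a_1(x,y)^p, a_{s+1}(x,y)^p a_s(x,y)⁻¹, s = 1, 2, …⟩`, sending the coset of `a_i` to
the coset of `a_i(x,y)` for every `i ≥ 1`. -/
theorem prufer_embed (p : ℕ) (hp : p.Prime) :
    ∃ φ : (FreeGroup ℕ ⧸ Subgroup.normalClosure (pruferRels p)) →*
        (F2 ⧸ Subgroup.normalClosure (pruferTargetRels p)),
      Function.Injective φ ∧
      ∀ i : ℕ,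
        φ (QuotientGroup.mk (FreeGroup.of i))
          = QuotientGroup.mk (aa (i + 1)) := by
  obtain ⟨G, _, j, f, hj, hf⟩ := exists_overgroup_aa
    fun i => (QuotientGroup.mk (FreeGroup.of i) :
      FreeGroup ℕ ⧸ Subgroup.normalClosure (pruferRels p))
  let g : FreeGroup ℕ →* F2 ⧸ Subgroup.normalClosure (pruferTargetRels p) :=
    FreeGroup.lift fun i => QuotientGroup.mk (aa (i + 1))
  have hg : Subgroup.normalClosure (pruferRels p) ≤ g.ker := by
    refine Subgroup.normalClosure_le_normal ?_
    rintro w (rfl | ⟨s, rfl⟩)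
    · have h := (QuotientGroup.eq_one_iff _).2 (Subgroup.subset_normalClosure
        (show aa 1 ^ p ∈ pruferTargetRels p from Or.inl rfl))
      simpa [g, MonoidHom.mem_ker] using h
    · have h := (QuotientGroup.eq_one_iff _).2 (Subgroup.subset_normalClosure
        (show aa (s + 1 + 1) ^ p * (aa (s + 1))⁻¹ ∈ pruferTargetRels p from
          Or.inr ⟨s + 1, Nat.le_add_left 1 s, rfl⟩))
      simpa [g, MonoidHom.mem_ker] using h
  have hfker : Subgroup.normalClosure (pruferTargetRels p) ≤ f.ker := by
    refine Subgroup.normalClosure_le_normal ?_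
    rintro w (rfl | ⟨s, hs, rfl⟩)
    · have h := (QuotientGroup.eq_one_iff _).2 (Subgroup.subset_normalClosure
        (show FreeGroup.of 0 ^ p ∈ pruferRels p from Or.inl rfl))
      rw [SetLike.mem_coe, MonoidHom.mem_ker, map_pow, ← zero_add 1, hf, ← map_pow,
        ← QuotientGroup.mk_pow, h, map_one]
    · obtain ⟨s, rfl⟩ := Nat.exists_eq_add_of_le' hs
      have h := (QuotientGroup.eq_one_iff _).2 (Subgroup.subset_normalClosure
        (show FreeGroup.of (s + 1) ^ p * (FreeGroup.of s)⁻¹ ∈ pruferRels p from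
          Or.inr ⟨s, rfl⟩))
      rw [SetLike.mem_coe, MonoidHom.mem_ker, map_mul, map_inv, map_pow, hf, hf, ← map_pow,
        ← map_inv, ← map_mul, ← QuotientGroup.mk_pow, ← QuotientGroup.mk_inv,
        ← QuotientGroup.mk_mul, h, map_one]
  have hcomp : (QuotientGroup.lift _ f hfker).comp (QuotientGroup.lift _ g hg) = j := by
    ext i
    simp [g, hf]
  refine ⟨QuotientGroup.lift _ g hg, ?_, fun i => by simp [g]⟩
  refine Function.Injective.of_comp (f := QuotientGroup.lift _ f hfker) ?_
  rw [← MonoidHom.coe_comp, hcomp]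
  exact hj
end
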